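/- arXiv:1803.07118 — 2 statements merged into one kernel-verified Lean document; each statement's English description precedes it below -/
import Mathlib

section
/- An algebraically closed field M is κ⁺-saturated as a model (every type over a subset of size ≤ κ is realized) if and only if its transcendence degree over its prime field is at least κ⁺. -/
open FirstOrder Cardinal

/-- `M` is `κ⁺`-saturated for the language `L`: every maximal finitely
satisfiable set of formulas in one free variable with parameters from a subset
`A` of `M` with `#A ≤ κ` is realized in `M`. -/
def IsSaturatedSucc (L : FirstOrder.Language) (M : Type*) [L.Structure M]
    (κ : Cardinal) : Prop :=
  ∀ A : Set M, #A ≤ κ →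
    letI : (FirstOrder.Language.constantsOn ↥A).Structure M :=
      FirstOrder.Language.constantsOn.structure ((↑) : A → M)
    ∀ p : Set ((L[[↥A]]).Formula Unit),
      ((∀ s ⊆ p, s.Finite → ∃ x : M, ∀ φ ∈ s, φ.Realize fun _ : Unit => x) ∧
        ∀ q : Set ((L[[↥A]]).Formula Unit), p ⊆ q →
          (∀ s ⊆ q, s.Finite → ∃ x : M, ∀ φ ∈ s, φ.Realize fun _ : Unit => x) →
          q = p) →
      ∃ x : M, ∀ φ ∈ p, φ.Realize fun _ : Unit => x

namespace FirstOrder.Language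

universe u v w w'

variable {L : Language.{u, v}}

/-- A map preserving all true formulas with parameters is an elementary embedding. -/
def ElementaryEmbedding.ofRealize {M : Type w} {N : Type w'} [L.Structure M] [L.Structure N]
    (f : M → N) (hf : ∀ φ : L.Formula M, φ.Realize id → φ.Realize f) : M ↪ₑ[L] N where
  toFun := f
  map_formula' n φ x := by
    have h (ψ : L.Formula (Fin n)) (hψ : ψ.Realize x) : ψ.Realize (f ∘ x) :=
      Formula.realize_relabel.1 (hf (ψ.relabel x) (Formula.realize_relabel.2 hψ))
    refine ⟨fun hφ => ?_, h φ⟩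
    by_contra hn
    exact Formula.realize_not.1 (h φ.not (Formula.realize_not.2 hn)) hφ

/-- A set of formulas in one free variable with parameters in an infinite structure `M` which is
finitely satisfiable in `M` is realized in an elementary extension of `M` of cardinality `#M`,
provided that `L` has at most `#M` symbols. -/
theorem exists_elementaryEmbedding_realize_card_eq {M : Type w} [L.Structure M] [Infinite M]
    (hL : Cardinal.lift.{w} L.card ≤ Cardinal.lift.{max u v} #M)
    {p : Set (L.Formula (M ⊕ Unit))}
    (hp : ∀ s : Finset (L.Formula (M ⊕ Unit)), ↑s ⊆ p →
      ∃ x : M, ∀ φ ∈ s, φ.Realize (Sum.elim id fun _ => x)) :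
    ∃ (N : Type w) (_ : L.Structure N) (f : M ↪ₑ[L] N) (t : N),
      #N = #M ∧ ∀ φ ∈ p, φ.Realize (Sum.elim f fun _ => t) := by
  classical
  let D : Set (L.Formula (M ⊕ Unit)) :=
    (fun φ : L.Formula M => φ.relabel Sum.inl) '' {φ | φ.Realize id}
  let T : L[[M ⊕ Unit]].Theory := Formula.equivSentence '' (p ∪ D)
  have hT : T.IsSatisfiable := by
    rw [Theory.isSatisfiable_iff_isFinitelySatisfiable]
    intro T₀ hT₀
    obtain ⟨s, hs, rfl⟩ := Finset.subset_set_image_iff.1 hT₀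
    obtain ⟨x, hx⟩ := hp (s.filter (· ∈ p)) (by simp [Set.subset_def])
    let : (constantsOn (M ⊕ Unit)).Structure M :=
      constantsOn.structure (Sum.elim id fun _ => x)
    have : M ⊨ ((s.image Formula.equivSentence : Finset _) : L[[M ⊕ Unit]].Theory) := by
      refine ⟨fun φ hφ => ?_⟩
      obtain ⟨ψ, hψ, rfl⟩ := Finset.mem_image.1 (Finset.mem_coe.1 hφ)
      rw [Formula.realize_equivSentence]
      change ψ.Realize (Sum.elim id fun _ => x)
      rcases hs hψ with h | ⟨χ, hχ, rfl⟩
      · exact hx ψ (Finset.mem_filter.2 ⟨hψ, h⟩)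
      · simpa [Formula.realize_relabel] using hχ
    exact Theory.Model.isSatisfiable M
  obtain ⟨N₀⟩ := hT
  have : Infinite N₀ := by
    let := (L.lhomWithConstants (M ⊕ Unit)).reduct N₀
    let f : M ↪ₑ[L] N₀ := .ofRealize (fun a => (L.con (Sum.inl a : M ⊕ Unit) : N₀)) fun φ hφ =>
      Formula.realize_relabel.1 <| (Formula.realize_equivSentence N₀ _).1 <|
        T.realize_sentence_of_mem
          (Set.mem_image_of_mem _ (Or.inr (Set.mem_image_of_mem _ hφ)))
    exact Infinite.of_injective f f.injective
  obtain ⟨N, hN⟩ := Theory.exists_model_card_eq ⟨N₀, this⟩ #M (aleph0_le_mk M) (by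
    rw [← lift_umax.{w, max u v}] at hL
    simp only [card_withConstants, mk_sum, mk_unit, lift_add, lift_lift, lift_one]
    refine add_le_of_le (by simp) hL ?_
    simp)
  let := (L.lhomWithConstants (M ⊕ Unit)).reduct N
  have key : ∀ φ ∈ p ∪ D, φ.Realize fun a => (L.con a : N) := fun φ hφ =>
    (Formula.realize_equivSentence N φ).1
      (T.realize_sentence_of_mem (Set.mem_image_of_mem _ hφ))
  let f : M ↪ₑ[L] N := .ofRealize (fun a => (L.con (Sum.inl a : M ⊕ Unit) : N)) fun φ hφ =>
    Formula.realize_relabel.1 (key _ (Or.inr (Set.mem_image_of_mem _ hφ)))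
  refine ⟨N, inferInstance, f, (L.con (Sum.inr () : M ⊕ Unit) : N), hN, fun φ hφ => ?_⟩
  convert key φ (Or.inl hφ) using 1
  ext (a | a) <;> rfl

/-- A `κ⁺`-saturated infinite structure has more than `κ` elements. -/
theorem _root_.IsSaturatedSucc.lt_mk {M : Type w} [L.Structure M] [Infinite M]
    {κ : Cardinal.{w}} (h : IsSaturatedSucc L M κ) : κ < #M := by
  by_contra! hM
  obtain ⟨A, hA⟩ : ∃ A : Set M, A = Set.univ := ⟨_, rfl⟩
  let U := Filter.hyperfilter M
  let : (constantsOn A).Structure M :=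
    constantsOn.structure ((↑) : A → M)
  let p : Set (L[[A]].Formula Unit) :=
    {φ | ∀ᶠ x in (U : Filter M), φ.Realize fun _ : Unit => x}
  obtain ⟨x, hx⟩ : ∃ x : M, ∀ φ ∈ p, φ.Realize fun _ : Unit => x := by
    refine h A ((mk_set_le A).trans hM) p ⟨fun s hs hfin => ?_, fun q hpq hq => ?_⟩
    · exact ((hfin.eventually_all).2 fun φ hφ => hs hφ).exists
    · refine (Set.Subset.antisymm hpq fun φ hφ => ?_).symm
      by_contra hn
      have hnot : φ.not ∈ p :=
        (Ultrafilter.eventually_not.2 hn).mono fun _ => Formula.realize_not.2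
      obtain ⟨x, hx⟩ := hq {φ, φ.not} (Set.pair_subset hφ (hpq hnot)) (Set.toFinite _)
      exact Formula.realize_not.1 (hx φ.not (by simp)) (hx φ (by simp))
  let φ : L[[A]].Formula Unit :=
    (Term.equal (Term.var ()) (L.con (⟨x, hA ▸ trivial⟩ : A)).term).not
  have hφ (y : M) : φ.Realize (fun _ : Unit => y) ↔ y ≠ x := by
    simp only [φ, Formula.realize_not, Formula.realize_equal, Term.realize_var,
      Term.realize_constants]
    rfl
  refine (hφ x).1 (hx φ ?_) rfl
  change ∀ᶠ y in (U : Filter M), _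
  simp only [hφ]
  exact Filter.hyperfilter_le_cofinite (Set.finite_singleton x).compl_mem_cofinite

end FirstOrder.Language

theorem FirstOrder.Ring.exists_ringHom_of_embedding {M N : Type*} [Ring M] [Ring N]
    [CompatibleRing M] [CompatibleRing N] (f : M ↪[Language.ring] N) :
    ∃ g : M →+* N, ∀ x, g x = f x := by
  refine ⟨{ toFun := f, map_one' := ?_, map_mul' := fun x y => ?_, map_zero' := ?_,
            map_add' := fun x y => ?_ }, fun _ => rfl⟩
  · simpa using f.map_fun oneFunc ![]
  · simpa using f.map_fun mulFunc ![x, y]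
  · simpa using f.map_fun zeroFunc ![]
  · simpa using f.map_fun addFunc ![x, y]

theorem IsTranscendenceBasis.nonempty_algEquiv {R K L ι κ : Type*} [CommRing R] [Field K]
    [Field L] [Algebra R K] [Algebra R L] [IsAlgClosed K] [IsAlgClosed L] {v : ι → K} {w : κ → L}
    (hv : IsTranscendenceBasis R v) (hw : IsTranscendenceBasis R w) (e : ι ≃ κ) :
    Nonempty (K ≃ₐ[R] L) := by
  let := IsAlgClosed.isAlgClosure_of_transcendence_basis v hv
  let := IsAlgClosed.isAlgClosure_of_transcendence_basis w hw
  let g : Algebra.adjoin R (Set.range v) ≃ₐ[R] Algebra.adjoin R (Set.range w) :=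
    hv.1.aevalEquiv.symm.trans ((MvPolynomial.renameEquiv R e).trans hw.1.aevalEquiv)
  refine ⟨AlgEquiv.ofRingEquiv (f := IsAlgClosure.equivOfEquiv K L g.toRingEquiv) fun r => ?_⟩
  rw [IsScalarTower.algebraMap_apply R (Algebra.adjoin R (Set.range v)) K,
    IsAlgClosure.equivOfEquiv_algebraMap,
    IsScalarTower.algebraMap_apply R (Algebra.adjoin R (Set.range w)) L]
  exact congrArg _ (g.commutes r)

namespace IsAlgClosed

universe u

theorem mk_eq_of_isTranscendenceBasis {R K ι : Type u} [CommRing R] [Field K] [Algebra R K]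
    [IsAlgClosed K] {v : ι → K} (hv : IsTranscendenceBasis R v) (hK : ℵ₀ < #K) (hR : #R < #K) :
    #ι = #K := by
  have : Nontrivial R := (algebraMap R K).domain_nontrivial
  refine (mk_le_of_injective hv.1.injective).antisymm ?_
  have h := cardinal_le_max_transcendence_basis' v hv
  simpa [hK.not_ge, hR.not_ge] using h

/-- Two uncountable algebraically closed extensions of a ring `R` which have the same cardinality,
larger than that of `R`, are isomorphic over `R`. -/
theorem nonempty_algEquiv_of_mk_eq {R K L : Type u} [CommRing R] [Field K] [Field L]
    [Algebra R K] [Algebra R L] [FaithfulSMul R K] [FaithfulSMul R L] [IsAlgClosed K]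
    [IsAlgClosed L] (hK : ℵ₀ < #K) (hR : #R < #K) (hKL : #K = #L) : Nonempty (K ≃ₐ[R] L) := by
  obtain ⟨s, hs⟩ := exists_isTranscendenceBasis R K
  obtain ⟨t, ht⟩ := exists_isTranscendenceBasis R L
  have hst : #s = #t := by
    rw [mk_eq_of_isTranscendenceBasis hs hK hR, hKL,
      mk_eq_of_isTranscendenceBasis ht (hKL ▸ hK) (hKL ▸ hR)]
  exact hs.nonempty_algEquiv ht (Cardinal.eq.1 hst).some

/-- An algebraically closed field with more than `κ` elements is `κ⁺`-saturated. -/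
theorem isSaturatedSucc_of_lt_mk {M : Type u} [Field M] [IsAlgClosed M] [Ring.CompatibleRing M]
    {κ : Cardinal.{u}} (hκ : ℵ₀ ≤ κ) (hM : κ < #M) :
    IsSaturatedSucc Language.ring M κ := by
  intro A hA
  let : (Language.constantsOn A).Structure M := Language.constantsOn.structure ((↑) : A → M)
  rintro p ⟨hp, _⟩
  let F (φ : Language.ring[[A]].Formula Unit) : Language.ring.Formula (A ⊕ Unit) :=
    Language.BoundedFormula.constantsVarsEquiv φ
  have hF (φ : Language.ring[[A]].Formula Unit) (x : M) :
      (F φ).Realize (Sum.elim (↑) fun _ => x) ↔ φ.Realize fun _ => x :=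
    Language.BoundedFormula.realize_constantsVarsEquiv
  let G (φ : Language.ring[[A]].Formula Unit) : Language.ring.Formula (M ⊕ Unit) :=
    (F φ).relabel (Sum.map (↑) id)
  obtain ⟨N, _, f, t, hN, ht⟩ :=
    Language.exists_elementaryEmbedding_realize_card_eq (M := M) (p := G '' p)
      (by simpa using (natCast_lt_aleph0 (n := 5)).le.trans (aleph0_le_mk M)) fun s hs => by
        classical
        obtain ⟨s, hsp, rfl⟩ := Finset.subset_set_image_iff.1 hs
        obtain ⟨x, hx⟩ := hp s hsp s.finite_toSet
        refine ⟨x, Finset.forall_mem_image.2 fun φ hφ => Language.Formula.realize_relabel.2 ?_⟩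
        rw [Sum.elim_comp_map]
        exact (hF φ x).2 (hx φ hφ)
  let c := ringChar M
  have : Language.Theory.ACF c |>.Model N := f.elementarilyEquivalent.theory_model
  let := Field.fieldOfModelACF c N
  have := Field.modelField_of_modelACF c N
  let := Field.compatibleRingOfModelField N
  have := Field.isAlgClosed_of_model_ACF c N
  obtain ⟨g, hg⟩ := Ring.exists_ringHom_of_embedding f.toEmbedding
  let k := Subfield.closure A
  have hk : #k ≤ κ := (Subfield.cardinalMk_closure_le_max A).trans (max_le hA hκ)
  let : Algebra k N := (g.comp (algebraMap k M)).toAlgebra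
  obtain ⟨e⟩ := nonempty_algEquiv_of_mk_eq (R := k) (hκ.trans_lt hM) (hk.trans_lt hM) hN.symm
  have he (a : A) : e.symm (f a) = a := by
    rw [AlgEquiv.symm_apply_eq]
    exact (hg a).symm.trans (e.commutes ⟨a, Subfield.subset_closure a.2⟩).symm
  let E : N ≃[Language.ring] M :=
    Ring.languageEquivEquivRingEquiv.symm e.symm.toRingEquiv
  refine ⟨e.symm t, fun φ hφ => ?_⟩
  have h := Language.Formula.realize_relabel.1 (ht _ (Set.mem_image_of_mem G hφ))
  rw [← hF]
  convert (Language.StrongHomClass.realize_formula E (F φ)).2 h using 1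
  ext (a | a)
  · exact (he a).symm
  · rfl

end IsAlgClosed

/-- An algebraically closed field is `κ⁺`-saturated iff its transcendence
degree over its prime field is at least `κ⁺`. -/
theorem acf_saturated_iff_trdeg (M : Type*) [Field M] [IsAlgClosed M]
    (κ : Cardinal) (hκ : ℵ₀ ≤ κ) :
    letI := FirstOrder.Ring.compatibleRingOfRing M
    (IsSaturatedSucc FirstOrder.Language.ring M κ ↔
      ∃ s : Set M, Order.succ κ ≤ #s ∧
        AlgebraicIndependent (⊥ : Subfield M) ((↑) : s → M)) := by
  let := FirstOrder.Ring.compatibleRingOfRing M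
  refine ⟨fun h => ?_, fun ⟨s, hs, _⟩ =>
    IsAlgClosed.isSaturatedSucc_of_lt_mk hκ
      ((Order.lt_succ κ).trans_le (hs.trans (mk_set_le s)))⟩
  have hM := h.lt_mk
  have hbot : #(⊥ : Subfield M) ≤ ℵ₀ := by
    rw [← Subfield.closure_empty]
    simpa using Subfield.cardinalMk_closure_le_max (∅ : Set M)
  obtain ⟨s, hs⟩ := exists_isTranscendenceBasis (⊥ : Subfield M) M
  refine ⟨s, Order.succ_le_of_lt ?_, hs.1⟩
  rwa [IsAlgClosed.mk_eq_of_isTranscendenceBasis hs (hκ.trans_lt hM)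
    (hbot.trans_lt (hκ.trans_lt hM))]
end

section
/- For a countable complete first-order theory T (where T is unstable in a cardinal λ if some model M of T of size λ has more than λ complete 1-types over M), T is either stable in every λ satisfying λ^{|T|} = λ, or unstable in every infinite λ. -/
open FirstOrder Cardinal

universe u v

/-- `T` is stable in `lam`: every model of `T` of cardinality `lam` has exactly
`lam` complete 1-types over it. -/
def StableIn {L : FirstOrder.Language.{u, v}} (T : L.Theory)
    (lam : Cardinal.{max u v}) : Prop :=
  ∀ (M : Type max u v) [L.Structure M] [Nonempty M], M ⊨ T → #M = lam →
    #((L.elementaryDiagram M).CompleteType Unit) = lam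

universe w z

/-- A family of more than `lam` predicates on a type with at most `lam` elements can be split at
some point into two families each still having more than `lam` members. -/
theorem Cardinal.exists_split {Y : Type w} {lam : Cardinal.{w}} (hlam : ℵ₀ ≤ lam) (hY : #Y ≤ lam)
    {Z : Set (Y → Prop)} (hZ : lam < #Z) :
    ∃ y, ∀ e : Bool, lam < #{f : Y → Prop | f ∈ Z ∧ (f y ↔ e = true)} := by
  by_contra! h
  choose e he using h
  refine hZ.not_ge ?_
  have hsub : Z ⊆ (⋃ y, {f : Y → Prop | f ∈ Z ∧ (f y ↔ e y = true)}) ∪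
      {fun y => ¬ e y = true} := by
    intro f hf
    by_cases hfy : ∃ y, (f y ↔ e y = true)
    · exact Or.inl (Set.mem_iUnion.2 (hfy.imp fun y hy => ⟨hf, hy⟩))
    · refine Or.inr (funext fun y => propext ?_)
      have := not_exists.1 hfy y
      tauto
  calc #Z ≤ _ := mk_le_mk_of_subset hsub
    _ ≤ _ := mk_union_le _ _
    _ ≤ lam + 1 := by
      refine add_le_add ?_ (by simp)
      refine (mk_iUnion_le _).trans ?_
      exact (mul_le_mul' hY (ciSup_le' he)).trans (mul_eq_self hlam).le
    _ = lam := add_one_eq hlam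

/-- A family of more than `lam` predicates on a type with at most `lam` elements shatters a
binary tree of height `ω`. -/
theorem Cardinal.exists_binary_tree {Y : Type w} {lam : Cardinal.{w}} (hlam : ℵ₀ ≤ lam) (hY : #Y ≤ lam)
    {X : Set (Y → Prop)} (hX : lam < #X) :
    ∃ b : List Bool → Y, ∀ s : List Bool, ∃ f ∈ X,
      ∀ e t, e :: t <:+ s → (f (b t) ↔ e = true) := by
  choose y hy using fun Z : {Z : Set (Y → Prop) // lam < #Z} => exists_split hlam hY Z.2
  let Z : List Bool → {Z : Set (Y → Prop) // lam < #Z} := fun s =>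
    s.rec ⟨X, hX⟩ fun e _ Z => ⟨_, hy Z e⟩
  have key : ∀ s, ∀ f ∈ (Z s).1, f ∈ X ∧ ∀ e t, e :: t <:+ s → (f (y (Z t)) ↔ e = true) := by
    intro s
    induction s with
    | nil => exact fun f hf => ⟨hf, by simp⟩
    | cons e s ih =>
      intro f hf
      refine ⟨(ih f hf.1).1, fun e' t h => ?_⟩
      rcases List.suffix_cons_iff.1 h with h | h
      · obtain ⟨rfl, rfl⟩ := List.cons.inj h
        exact hf.2
      · exact (ih f hf.1).2 e' t h
  refine ⟨fun s => y (Z s), fun s => ?_⟩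
  obtain ⟨f, hf⟩ : (Z s).1.Nonempty := by
    rw [← Set.nonempty_coe_sort, ← mk_ne_zero_iff]
    exact (zero_le.trans_lt (Z s).2).ne'
  exact ⟨f, key s f hf⟩

/-- Every infinite `mu` admits a well-ordered `I` with more than `mu` branches but at most `mu`
nodes in its binary tree. -/
theorem Cardinal.exists_linearOrder_lt_two_power {mu : Cardinal.{w}} (hmu : ℵ₀ ≤ mu) :
    ∃ (I : Type w) (_ : LinearOrder I) (_ : WellFoundedLT I), mu < #(I → Bool) ∧
      #(Σ i : I, (Set.Iio i → Bool)) ≤ mu := by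
  have hne : {k : Cardinal.{w} | mu < 2 ^ k}.Nonempty := ⟨mu, cantor mu⟩
  set k := sInf {k : Cardinal.{w} | mu < 2 ^ k} with hk
  have hk1 : mu < 2 ^ k := csInf_mem hne
  have hk2 : k ≤ mu := csInf_le' (cantor mu)
  refine ⟨k.ord.ToType, inferInstance, inferInstance, by simpa using hk1, ?_⟩
  rw [mk_sigma]
  refine (sum_le_mk_mul_iSup _).trans ?_
  refine (mul_le_mul' ((mk_ord_toType k).le.trans hk2) (ciSup_le' fun i => ?_)).trans
    (mul_eq_self hmu).le
  have hi : #(Set.Iio i) < k := by simpa using mk_Iio_lt i (by simp)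
  simpa using notMem_of_lt_csInf' hi

theorem Finset.cons_map_sort_filter_lt_suffix {I β : Type*} [LinearOrder I] (η : I → β)
    (A : Finset I) {i : I} (hi : i ∈ A) :
    η i :: ((A.filter (· < i)).sort (· ≥ ·)).map η <:+ (A.sort (· ≥ ·)).map η := by
  induction A using Finset.induction_on_max with
  | empty => simp at hi
  | insert m A hm ih =>
    have hmA : m ∉ A := fun h => (hm m h).false
    rw [Finset.sort_insert _ (fun b hb => (hm b hb).le) hmA, List.map_cons]
    rcases Finset.mem_insert.1 hi with rfl | hi
    · have : (insert i A).filter (· < i) = A := by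
        ext j
        simp only [Finset.mem_filter, Finset.mem_insert]
        exact ⟨fun h => h.1.resolve_left h.2.ne, fun h => ⟨Or.inr h, hm j h⟩⟩
      rw [this]
    · have : (insert m A).filter (· < i) = A.filter (· < i) := by
        rw [Finset.filter_insert, if_neg (hm i hi).not_gt]
      rw [this]
      exact (ih hi).trans (List.suffix_cons _ _)

namespace FirstOrder.Language

open Theory

variable {L : Language.{u, v}}

theorem countable_formula_of_card_le {α : Type w} [Countable α] (hL : L.card ≤ ℵ₀) :
    Countable (L.Formula α) := by
  have h : #(Σ n, L.BoundedFormula α n) ≤ ℵ₀ := by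
    refine BoundedFormula.card_le.trans (max_le le_rfl ?_)
    simp [add_le_aleph0, hL]
  have : Countable (Σ n, L.BoundedFormula α n) := mk_le_aleph0_iff.1 h
  exact Function.Injective.countable (f := fun φ : L.Formula α =>
    (⟨0, φ⟩ : Σ n, L.BoundedFormula α n)) fun φ ψ h => by simpa using h

variable {M : Type w}

/-- The formula with parameters in `M` obtained by substituting a sequence of parameters. -/
noncomputable def Formula.withParams (φ : L.Formula (ℕ ⊕ Unit)) (a : ℕ → M) :
    L[[M]].Formula Unit :=
  BoundedFormula.constantsVarsEquiv.symm (φ.relabel (Sum.map a id))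

section Expansion

variable {N : Type z} [L.Structure N] [L[[M]].Structure N]
  [(L.lhomWithConstants M).IsExpansionOn N]

theorem Formula.realize_withParams (φ : L.Formula (ℕ ⊕ Unit)) (a : ℕ → M) (v : Unit → N) :
    (φ.withParams a).Realize v ↔
      φ.Realize (Sum.elim (fun n => (L.con (a n) : N)) v) := by
  have h : BoundedFormula.constantsVarsEquiv (φ.withParams a) = φ.relabel (Sum.map a id) :=
    (BoundedFormula.constantsVarsEquiv (L := L) (γ := M) (α := Unit) (n := 0)).apply_symm_apply _
  rw [Formula.Realize, ← BoundedFormula.realize_constantsVarsEquiv, h]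
  refine (Formula.realize_relabel (φ := φ)).trans ?_
  rw [Sum.elim_comp_map]
  rfl

end Expansion

/-- Every formula over `M` is equivalent to a parameter-free formula evaluated at a sequence of
parameters. -/
theorem Formula.exists_withParams_realize_iff [Nonempty M] (ψ : L[[M]].Formula Unit) :
    ∃ (φ : L.Formula (ℕ ⊕ Unit)) (a : ℕ → M), ∀ (N : Type z) [L.Structure N]
      [L[[M]].Structure N] [(L.lhomWithConstants M).IsExpansionOn N] (v : Unit → N),
      (φ.withParams a).Realize v ↔ ψ.Realize v := by
  classical
  let χ : L.BoundedFormula (M ⊕ Unit) 0 := BoundedFormula.constantsVarsEquiv ψ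
  obtain ⟨g, hg⟩ := exists_injective_nat χ.freeVarFinset
  let d : M := Classical.arbitrary M
  let a : ℕ → M := Function.extend g (fun x => x.1.elim id fun _ => d) fun _ => d
  let f : χ.freeVarFinset → ℕ ⊕ Unit := fun x => x.1.elim (fun _ => Sum.inl (g x)) Sum.inr
  refine ⟨χ.restrictFreeVar f, a, fun N _ _ _ v => ?_⟩
  rw [Formula.realize_withParams, Formula.Realize, Formula.Realize,
    ← BoundedFormula.realize_constantsVarsEquiv (φ := ψ)]
  refine BoundedFormula.realize_restrictFreeVar _ ?_
  rintro ⟨m | x, hx⟩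
  · have : a (g ⟨Sum.inl m, hx⟩) = m := hg.extend_apply _ _ _
    simp [f, this]
  · simp [f]

namespace Theory.CompleteType

variable [L.Structure M]

/-- The `φ`-part of a complete type over `M`. -/
def trace (p : (L.elementaryDiagram M).CompleteType Unit) (φ : L.Formula (ℕ ⊕ Unit))
    (a : ℕ → M) : Prop :=
  Formula.equivSentence (φ.withParams a) ∈ p

theorem exists_realization (p : (L.elementaryDiagram M).CompleteType Unit) :
    ∃ (N : Type max u v w) (_ : L.Structure N) (_ : L[[M]].Structure N) (_ : Nonempty N)
      (_ : (L.lhomWithConstants M).IsExpansionOn N) (_ : N ⊨ L.elementaryDiagram M)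
      (v : Unit → N), (L.elementaryDiagram M).typeOf v = p := by
  obtain ⟨N, v, hv⟩ := exists_modelType_is_realized_in _ p
  let := (L.lhomWithConstants M).reduct N
  exact ⟨N, inferInstance, inferInstance, inferInstance, inferInstance, inferInstance, v, hv⟩

theorem trace_typeOf {N : Type z} [L.Structure N] [L[[M]].Structure N] [Nonempty N]
    [(L.lhomWithConstants M).IsExpansionOn N] [N ⊨ L.elementaryDiagram M] (v : Unit → N)
    (φ : L.Formula (ℕ ⊕ Unit)) (a : ℕ → M) :
    ((L.elementaryDiagram M).typeOf v).trace φ a ↔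
      φ.Realize (Sum.elim (fun n => (L.con (a n) : N)) v) := by
  rw [trace, formula_mem_typeOf, Formula.realize_withParams]

theorem trace_injective [Nonempty M] :
    Function.Injective (trace : (L.elementaryDiagram M).CompleteType Unit → _) := by
  intro p q h
  refine SetLike.ext fun σ => ?_
  obtain ⟨φ, a, hφ⟩ :=
    Formula.exists_withParams_realize_iff.{u, v, w, max u v w} (L := L) (M := M)
      (Formula.equivSentence.symm σ)
  have key : ∀ r : (L.elementaryDiagram M).CompleteType Unit, σ ∈ r ↔ r.trace φ a := by
    intro r
    obtain ⟨N, _, _, _, _, _, v, rfl⟩ := r.exists_realization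
    rw [mem_typeOf, trace, formula_mem_typeOf]
    exact (hφ N v).symm
  rw [key, key, h]

/-- Types over `M` are finitely satisfiable in `M`. -/
theorem exists_realize_iff_trace (p : (L.elementaryDiagram M).CompleteType Unit)
    (φ : L.Formula (ℕ ⊕ Unit)) {ι : Type z} [Finite ι] (a : ι → ℕ → M) :
    ∃ c : M, ∀ i, φ.Realize (Sum.elim (a i) fun _ => c) ↔ p.trace φ (a i) := by
  classical
  obtain ⟨N, _, _, _, _, _, v, rfl⟩ := p.exists_realization
  let t : ι → L.Formula (M ⊕ Unit) := fun i =>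
    if ((L.elementaryDiagram M).typeOf v).trace φ (a i) then φ.relabel (Sum.map (a i) id)
    else ∼(φ.relabel (Sum.map (a i) id))
  let θ : L.Formula M := (Formula.iInf t).iExs Unit
  have hN : θ.Realize fun m => (L.con m : N) := by
    rw [Formula.realize_iExs]
    refine ⟨v, Formula.realize_iInf.2 fun i => ?_⟩
    have := trace_typeOf v φ (a i)
    by_cases h : ((L.elementaryDiagram M).typeOf v).trace φ (a i)
    · simp only [t, if_pos h, Formula.realize_relabel, Sum.elim_comp_map]
      exact this.1 h
    · simp only [t, if_neg h, Formula.realize_not, Formula.realize_relabel, Sum.elim_comp_map]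
      exact fun h' => h (this.2 h')
  have hM : θ.Realize (id : M → M) :=
    ((ElementaryEmbedding.ofModelsElementaryDiagram L M N).map_formula θ id).1 hN
  obtain ⟨c, hc⟩ := Formula.realize_iExs.1 hM
  refine ⟨c (), fun i => ?_⟩
  have hi := Formula.realize_iInf.1 hc i
  by_cases h : ((L.elementaryDiagram M).typeOf v).trace φ (a i)
  · simp only [t, if_pos h, Formula.realize_relabel, Sum.elim_comp_map] at hi
    exact iff_of_true hi h
  · simp only [t, if_neg h, Formula.realize_not, Formula.realize_relabel, Sum.elim_comp_map] at hi
    exact iff_of_false hi h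

end Theory.CompleteType

open Theory.CompleteType

variable [L.Structure M]

theorem mk_le_mk_completeType [Nonempty M] :
    lift.{max u v} #M ≤ #((L.elementaryDiagram M).CompleteType Unit) := by
  have hinj : Function.Injective fun m : ULift.{max u v} M =>
      (L.elementaryDiagram M).typeOf fun _ : Unit => m.down := by
    intro m m' h
    let φ : L.Formula (ℕ ⊕ Unit) :=
      Term.equal (Term.var (Sum.inl 0)) (Term.var (Sum.inr ()))
    have key : ∀ x : ULift.{max u v} M,
        ((L.elementaryDiagram M).typeOf fun _ : Unit => x.down).trace φ (fun _ => m.down) ↔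
          m.down = x.down := by
      intro x
      rw [trace_typeOf]
      simp only [φ, Formula.realize_equal, Term.realize_var, Sum.elim_inl, Sum.elim_inr]
      rfl
    have := (key m).2 rfl
    dsimp only at h
    rw [h, key] at this
    exact ULift.down_injective this
  simpa using mk_le_of_injective hinj

/-- The formula `φ` shatters a binary tree of height `ω` in `M`. -/
def HasBinaryTree (φ : L.Formula (ℕ ⊕ Unit)) (M : Type w) [L.Structure M] : Prop :=
  ∃ b : List Bool → ℕ → M, ∀ s : List Bool, ∃ c : M,
    ∀ e t, e :: t <:+ s → (φ.Realize (Sum.elim (b t) fun _ => c) ↔ e = true)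

theorem exists_hasBinaryTree {L : Language.{u, v}} (hL : L.card ≤ ℵ₀) {lam : Cardinal.{max u v}}
    (hlam : ℵ₀ ≤ lam) (hpow : lam ^ (ℵ₀ : Cardinal) = lam) {M : Type max u v} [L.Structure M]
    [Nonempty M] (hM : #M = lam) (hS : lam < #((L.elementaryDiagram M).CompleteType Unit)) :
    ∃ φ : L.Formula (ℕ ⊕ Unit), HasBinaryTree φ M := by
  have : Countable (L.Formula (ℕ ⊕ Unit)) := countable_formula_of_card_le hL
  let X : L.Formula (ℕ ⊕ Unit) → Set ((ℕ → M) → Prop) := fun φ =>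
    Set.range fun p : (L.elementaryDiagram M).CompleteType Unit => p.trace φ
  obtain ⟨φ, hφ⟩ : ∃ φ, lam < #(X φ) := by
    by_contra! h
    refine hS.not_ge ?_
    have hinj : Function.Injective
        fun (p : (L.elementaryDiagram M).CompleteType Unit) (φ : L.Formula (ℕ ⊕ Unit)) =>
          (⟨p.trace φ, p, rfl⟩ : X φ) := fun p q hpq =>
      trace_injective (funext fun φ => congrArg Subtype.val (congrFun hpq φ))
    calc _ ≤ #(∀ φ, X φ) := mk_le_of_injective hinj
      _ = Cardinal.prod fun φ => #(X φ) := mk_pi _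
      _ ≤ Cardinal.prod fun _ : L.Formula (ℕ ⊕ Unit) => lam := prod_le_prod _ _ h
      _ = lam ^ #(L.Formula (ℕ ⊕ Unit)) := prod_const' _ _
      _ ≤ lam ^ (ℵ₀ : Cardinal) :=
        power_le_power_left (aleph0_pos.trans_le hlam).ne' mk_le_aleph0
      _ = lam := hpow
  have hY : #(ℕ → M) ≤ lam := by simp [hM, hpow]
  obtain ⟨b, hb⟩ := exists_binary_tree hlam hY hφ
  refine ⟨φ, b, fun s => ?_⟩
  obtain ⟨_, ⟨p, rfl⟩, hp⟩ := hb s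
  obtain ⟨c, hc⟩ := p.exists_realize_iff_trace φ (ι := {t // t ∈ s.tails}) fun t => b t.1
  refine ⟨c, fun e t h => ?_⟩
  rw [hc ⟨t, (List.mem_tails _ _).2 ((List.suffix_cons e t).trans h)⟩]
  exact hp e t h

/-- If `φ` shatters a binary tree of height `ω` in `M`, then in some ultrapower of `M` it shatters
the binary tree indexed by any given linear order. -/
theorem HasBinaryTree.exists_ultrapower {L : Language.{u, v}} {φ : L.Formula (ℕ ⊕ Unit)}
    {M : Type w} [L.Structure M] [Nonempty M] (h : HasBinaryTree φ M)
    (I : Type z) [LinearOrder I] :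
    ∃ (U : Ultrafilter (Finset I))
      (b : (Σ i : I, (Set.Iio i → Bool)) → ℕ → (U : Filter (Finset I)).Product fun _ => M)
      (c : (I → Bool) → (U : Filter (Finset I)).Product fun _ => M),
      ∀ η i, φ.Realize (Sum.elim (b ⟨i, fun j => η j⟩) fun _ => c η) ↔ η i = true := by
  classical
  obtain ⟨b, hb⟩ := h
  choose c hc using hb
  let ext : (Σ i : I, (Set.Iio i → Bool)) → I → Bool := fun s j =>
    if hj : j < s.1 then s.2 ⟨j, hj⟩ else false
  let b' : (Σ i : I, (Set.Iio i → Bool)) → ℕ → Finset I → M := fun s n A =>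
    b (((A.filter (· < s.1)).sort (· ≥ ·)).map (ext s)) n
  let c' : (I → Bool) → Finset I → M := fun η A => c ((A.sort (· ≥ ·)).map η)
  let U : Ultrafilter (Finset I) := Ultrafilter.of Filter.atTop
  have key : ∀ η i, ∀ A : Finset I, i ∈ A →
      (φ.Realize (Sum.elim (fun n => b' ⟨i, fun j => η j⟩ n A) fun _ => c' η A) ↔
        η i = true) := by
    intro η i A hi
    have hmap : ((A.filter (· < i)).sort (· ≥ ·)).map (ext ⟨i, fun j => η j⟩) =
        ((A.filter (· < i)).sort (· ≥ ·)).map η := by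
      refine List.map_congr_left fun j hj => ?_
      have hj' : j < i := (Finset.mem_filter.1 ((Finset.mem_sort _).1 hj)).2
      simp [ext, hj']
    simp only [b', hmap]
    exact hc _ _ _ (Finset.cons_map_sort_filter_lt_suffix η A hi)
  have hmem : ∀ i : I, ∀ᶠ A in (U : Filter (Finset I)), i ∈ A := fun i =>
    (Ultrafilter.of_le Filter.atTop) <|
      (Filter.eventually_ge_atTop {i}).mono fun A hA => Finset.singleton_subset_iff.1 hA
  refine ⟨U, fun s n => ((b' s n : Finset I → M) : (U : Filter (Finset I)).Product fun _ => M),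
    fun η => ((c' η : Finset I → M) : (U : Filter (Finset I)).Product fun _ => M),
    fun η i => ?_⟩
  have hcast := Ultraproduct.realize_formula_cast (u := U) (M := fun _ => M) φ
    (Sum.elim (b' ⟨i, fun j => η j⟩) fun _ => c' η)
  have hl : (fun x : ℕ ⊕ Unit => ((Sum.elim (b' ⟨i, fun j => η j⟩) (fun _ => c' η) x : Finset I → M) :
      (U : Filter (Finset I)).Product fun _ => M)) =
      Sum.elim (fun n => ((b' ⟨i, fun j => η j⟩ n : Finset I → M) :
        (U : Filter (Finset I)).Product fun _ => M)) fun _ => ((c' η : Finset I → M) :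
        (U : Filter (Finset I)).Product fun _ => M) := by
    funext x
    cases x <;> rfl
  have hr : ∀ A, (fun x => Sum.elim (b' ⟨i, fun j => η j⟩) (fun _ => c' η) x A) =
      Sum.elim (fun n => b' ⟨i, fun j => η j⟩ n A) fun _ : Unit => c' η A := by
    intro A
    funext x
    cases x <;> rfl
  rw [hl] at hcast
  refine hcast.trans ?_
  simp only [hr]
  constructor
  · intro h
    obtain ⟨A, hA, hiA⟩ := (h.and (hmem i)).exists
    exact (key η i A hiA).1 hA
  · intro h
    exact (hmem i).mono fun A hiA => (key η i A hiA).2 h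

theorem HasBinaryTree.not_stableIn {L : Language.{u, v}} (hL : L.card ≤ ℵ₀) {T : L.Theory}
    {φ : L.Formula (ℕ ⊕ Unit)} {M : Type max u v} [L.Structure M] [Nonempty M] (hM : M ⊨ T)
    (h : HasBinaryTree φ M) {mu : Cardinal.{max u v}} (hmu : ℵ₀ ≤ mu) : ¬ StableIn T mu := by
  intro hstable
  obtain ⟨I, _, _, hI, hnodes⟩ := exists_linearOrder_lt_two_power hmu
  obtain ⟨U, b, c, hbc⟩ := h.exists_ultrapower I
  let P := (U : Filter (Finset I)).Product fun _ => M
  have hP : P ⊨ T := ⟨fun σ hσ => (Ultraproduct.sentence_realize σ).2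
    (Filter.Eventually.of_forall fun _ => hM.realize_of_mem σ hσ)⟩
  have hsep : ∀ η η' : I → Bool, (∀ s, φ.Realize (Sum.elim (b s) fun _ => c η) ↔
      φ.Realize (Sum.elim (b s) fun _ => c η')) → η = η' := by
    intro η η' hη
    funext i
    induction i using WellFoundedLT.induction with
    | ind i ih =>
      have hi : (fun j : Set.Iio i => η j) = fun j : Set.Iio i => η' j := funext fun j => ih j j.2
      have h' := hbc η' i
      rw [← hi, ← hη, hbc] at h'
      exact Bool.eq_iff_iff.2 h'
  have hc : Function.Injective c := fun η η' h => hsep η η' fun s => by rw [h]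
  have hmuP : mu ≤ #P := hI.le.trans (mk_le_of_injective hc)
  obtain ⟨S, hbS, hS⟩ := exists_elementarySubstructure_card_eq L
    (Set.range fun x : (Σ i : I, (Set.Iio i → Bool)) × ℕ => (b x.1 x.2 : P)) mu hmu
    (by
      refine lift_le.2 (mk_range_le.trans ?_)
      simpa using (mul_le_mul' hnodes hmu).trans (mul_eq_self hmu).le)
    (lift_le_aleph0.2 hL |>.trans (aleph0_le_lift.2 hmu)) (lift_le.2 hmuP)
  let : (constantsOn S).Structure P := constantsOn.structure Subtype.val
  have hdiag : P ⊨ L.elementaryDiagram S := by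
    refine ⟨fun σ hσ => ?_⟩
    rw [← Formula.realize_equivSentence_symm_con P σ]
    exact (S.subtype.map_formula _ _).2 ((Formula.realize_equivSentence_symm_con S σ).2 hσ)
  have htypes := hstable S inferInstance (lift_inj.1 hS)
  have hinj : Function.Injective fun η : I → Bool =>
      (L.elementaryDiagram S).typeOf fun _ : Unit => (c η : P) := by
    intro η η' h
    refine hsep η η' fun s => ?_
    let a : ℕ → S := fun n => ⟨b s n, hbS ⟨(s, n), rfl⟩⟩
    have h1 := trace_typeOf (fun _ : Unit => (c η : P)) φ a
    have h2 := trace_typeOf (fun _ : Unit => (c η' : P)) φ a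
    dsimp only at h
    rw [h] at h1
    exact h1.symm.trans h2
  exact (hI.trans_le (mk_le_of_injective hinj)).ne' htypes

end FirstOrder.Language

/-- Shelah's stability spectrum dichotomy for countable complete theories:
`T` is either stable in every `lam` with `lam ^ ℵ₀ = lam`, or unstable in every
infinite `lam`. -/
theorem stability_spectrum {L : FirstOrder.Language.{u, v}}
    (hL : L.card ≤ ℵ₀) (T : L.Theory) (hT : T.IsComplete) :
    (∀ lam : Cardinal.{max u v}, ℵ₀ ≤ lam → lam ^ (ℵ₀ : Cardinal) = lam →
      StableIn T lam) ∨
    (∀ lam : Cardinal.{max u v}, ℵ₀ ≤ lam → ¬ StableIn T lam) := by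
  by_cases h : ∃ (φ : L.Formula (ℕ ⊕ Unit)) (M : Type max u v) (_ : L.Structure M)
      (_ : Nonempty M), M ⊨ T ∧ Language.HasBinaryTree φ M
  · obtain ⟨φ, M, _, _, hM, hφ⟩ := h
    exact Or.inr fun lam hlam => hφ.not_stableIn hL hM hlam
  · refine Or.inl fun lam hlam hpow M _ _ hM hcard => ?_
    refine le_antisymm (not_lt.1 fun hlt => h ?_) ?_
    · obtain ⟨φ, hφ⟩ := Language.exists_hasBinaryTree hL hlam hpow hcard hlt
      exact ⟨φ, M, inferInstance, inferInstance, hM, hφ⟩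
    · simpa [hcard] using Language.mk_le_mk_completeType (L := L) (M := M)
end
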